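/- If G is a minimal counterexample, then no cycle of length 4 in G contains a vertex of degree 2. -/

import Mathlib

open SimpleGraph

/-- A `(1,2^k)`-packing edge-coloring encoded as a function assigning a color in
`Fin (k+1)` to each unordered pair. Color `0` is the 1-color (its class must be a
matching) and each color `i ≠ 0` is a 2-color (its class must be an induced matching). -/
def IsPackingEC {V : Type} (G : SimpleGraph V) (k : ℕ)
    (c : Sym2 V → Fin (k + 1)) : Prop :=
  (∀ a b x y : V, G.Adj a b → G.Adj x y → s(a, b) ≠ s(x, y) →
      c s(a, b) = 0 → c s(x, y) = 0 →
      a ≠ x ∧ a ≠ y ∧ b ≠ x ∧ b ≠ y) ∧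
  ∀ a b x y : V, G.Adj a b → G.Adj x y → s(a, b) ≠ s(x, y) →
      c s(a, b) = c s(x, y) → c s(a, b) ≠ 0 →
      (a ≠ x ∧ a ≠ y ∧ b ≠ x ∧ b ≠ y) ∧
      ¬G.Adj a x ∧ ¬G.Adj a y ∧ ¬G.Adj b x ∧ ¬G.Adj b y

/-- A good coloring: a `(1,2^7)`-packing edge-coloring in which every edge of the
1-color class (color `0`) has both endpoints of degree 3. -/
def GoodColoring {V : Type} (G : SimpleGraph V) (c : Sym2 V → Fin 8) : Prop :=
  IsPackingEC G 7 c ∧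
  ∀ a b : V, G.Adj a b → c s(a, b) = 0 →
    (G.neighborSet a).ncard = 3 ∧ (G.neighborSet b).ncard = 3

/-- A graph is subcubic if every vertex has degree at most 3. -/
def Subcubic {V : Type} (G : SimpleGraph V) : Prop :=
  ∀ v : V, (G.neighborSet v).ncard ≤ 3

/-- A minimal counterexample: a finite subcubic simple graph with no good coloring such
that every finite subcubic simple graph with smaller `|V| + |E|` has a good coloring. -/
def MinCounter (V : Type) [Finite V] (G : SimpleGraph V) : Prop :=
  Subcubic G ∧
  (¬∃ c : Sym2 V → Fin 8, GoodColoring G c) ∧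
  ∀ (W : Type) [Finite W] (H : SimpleGraph W), Subcubic H →
    Nat.card W + H.edgeSet.ncard < Nat.card V + G.edgeSet.ncard →
    ∃ c : Sym2 W → Fin 8, GoodColoring H c

/-- The coloring `c` of the subgraph `H` satisfies the constraints of a good coloring, with
adjacencies and degrees measured in the ambient graph `G`. -/
def PartialGood {V : Type} (G H : SimpleGraph V) (c : Sym2 V → Fin 8) : Prop :=
  (∀ e ∈ H.edgeSet, ∀ f ∈ H.edgeSet, e ≠ f → c e = c f →
    ∀ x ∈ e, ∀ y ∈ f, x ≠ y ∧ (c e ≠ 0 → ¬G.Adj x y)) ∧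
  ∀ e ∈ H.edgeSet, c e = 0 → ∀ x ∈ e, (G.neighborSet x).ncard = 3

theorem PartialGood.goodColoring {V : Type} {G : SimpleGraph V} {c : Sym2 V → Fin 8}
    (h : PartialGood G G c) : GoodColoring G c := by
  obtain ⟨h1, h2⟩ := h
  refine ⟨⟨fun a b x y hab hxy hne ha hx => ?_, fun a b x y hab hxy hne he h0 => ?_⟩,
    fun a b hab h0 => ⟨h2 _ hab h0 a (by simp), h2 _ hab h0 b (by simp)⟩⟩
  · have := h1 _ hab _ hxy hne (ha.trans hx.symm)
    exact ⟨(this a (by simp) x (by simp)).1, (this a (by simp) y (by simp)).1,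
      (this b (by simp) x (by simp)).1, (this b (by simp) y (by simp)).1⟩
  · have := h1 _ hab _ hxy hne he
    have hax := this a (by simp) x (by simp)
    have hay := this a (by simp) y (by simp)
    have hbx := this b (by simp) x (by simp)
    have hby := this b (by simp) y (by simp)
    exact ⟨⟨hax.1, hay.1, hbx.1, hby.1⟩, hax.2 h0, hay.2 h0, hbx.2 h0, hby.2 h0⟩

/-- A good coloring of `G - u` satisfies the constraints inside `G`: an edge of `G` joining two
edges of `G - u` does not contain `u`. -/
theorem GoodColoring.partialGood_deleteIncidenceSet {V : Type} [Finite V] {G : SimpleGraph V}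
    {c : Sym2 V → Fin 8} {u : V} (hG : Subcubic G)
    (h : GoodColoring (G.deleteIncidenceSet u) c) :
    PartialGood G (G.deleteIncidenceSet u) c := by
  obtain ⟨⟨h0, h1⟩, h2⟩ := h
  have deg : ∀ x, ((G.deleteIncidenceSet u).neighborSet x).ncard = 3 →
      (G.neighborSet x).ncard = 3 := fun x hx =>
    le_antisymm (hG x) (hx ▸ Set.ncard_le_ncard
      (fun z hz => (G.deleteIncidenceSet_le u) hz) (Set.toFinite _))
  constructor
  · intro e he f hf
    induction e with | _ a b
    induction f with | _ x y
    intro hne hc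
    rw [mem_edgeSet] at he hf
    have ha := G.deleteIncidenceSet_adj.1 he
    have hx := G.deleteIncidenceSet_adj.1 hf
    by_cases hz : c s(a, b) = 0
    · have := h0 a b x y he hf hne hz (hc ▸ hz)
      simp only [Sym2.mem_iff]
      rintro _ (rfl | rfl) _ (rfl | rfl) <;> simp [this, hz]
    · have := h1 a b x y he hf hne hc hz
      simp only [deleteIncidenceSet_adj] at this
      simp only [Sym2.mem_iff]
      rintro _ (rfl | rfl) _ (rfl | rfl) <;> tauto
  · intro e he
    induction e with | _ a b
    intro hc
    have := h2 a b he hc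
    simp only [Sym2.mem_iff]
    rintro _ (rfl | rfl)
    exacts [deg _ this.1, deg _ this.2]

/-- An edge between vertices of degree 3 may be recolored `0` if no adjacent edge has
color `0`. -/
theorem PartialGood.update_zero {V : Type} [DecidableEq V] {G H : SimpleGraph V}
    {c : Sym2 V → Fin 8} (h : PartialGood G H c) {a b : V}
    (ha : (G.neighborSet a).ncard = 3) (hb : (G.neighborSet b).ncard = 3)
    (ha0 : ∀ x, H.Adj a x → x ≠ b → c s(a, x) ≠ 0)
    (hb0 : ∀ x, H.Adj b x → x ≠ a → c s(b, x) ≠ 0) :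
    PartialGood G H (Function.update c s(a, b) 0) := by
  obtain ⟨h1, h2⟩ := h
  have key : ∀ f ∈ H.edgeSet, f ≠ s(a, b) → c f = 0 → a ∉ f ∧ b ∉ f := by
    intro f hf hne hc
    constructor
    · intro hm
      obtain ⟨x, rfl⟩ := hm
      exact ha0 x hf (by rintro rfl; exact hne rfl) hc
    · intro hm
      obtain ⟨x, rfl⟩ := hm
      exact hb0 x hf (by rintro rfl; exact hne Sym2.eq_swap) hc
  constructor
  · intro e he f hf hne hc x hx y hy
    by_cases hea : e = s(a, b)
    · have hfa : f ≠ s(a, b) := fun h => hne (hea.trans h.symm)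
      simp only [hea, Function.update_self, Function.update_of_ne hfa] at hc ⊢
      have := key f hf hfa hc.symm
      rw [hea, Sym2.mem_iff] at hx
      refine ⟨?_, by simp⟩
      rintro rfl
      rcases hx with rfl | rfl <;> tauto
    · by_cases hfa : f = s(a, b)
      · simp only [hfa, Function.update_self, Function.update_of_ne hea] at hc ⊢
        have := key e he hea hc
        rw [hfa, Sym2.mem_iff] at hy
        refine ⟨?_, by simp [hc]⟩
        rintro rfl
        rcases hy with rfl | rfl <;> tauto
      · simp only [Function.update_of_ne hea, Function.update_of_ne hfa] at hc ⊢
        exact h1 e he f hf hne hc x hx y hy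
  · intro e he hc x hx
    by_cases hea : e = s(a, b)
    · rw [hea, Sym2.mem_iff] at hx
      rcases hx with rfl | rfl <;> assumption
    · rw [Function.update_of_ne hea] at hc
      exact h2 e he hc x hx

/-- A partial coloring extends to one more edge `e` if a nonzero color is unused near `e`. -/
theorem PartialGood.update_extend {V : Type} [DecidableEq V] {G H K : SimpleGraph V}
    {c : Sym2 V → Fin 8} (h : PartialGood G H c) {e : Sym2 V} {p : Fin 8}
    (hK : ∀ f ∈ K.edgeSet, f = e ∨ f ∈ H.edgeSet) (hp : p ≠ 0)
    (hfree : ∀ x ∈ e, ∀ f ∈ H.edgeSet, f ≠ e → c f = p → ∀ y ∈ f, x ≠ y ∧ ¬G.Adj x y) :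
    PartialGood G K (Function.update c e p) := by
  obtain ⟨h1, h2⟩ := h
  constructor
  · intro f hf g hg hne hc x hx y hy
    by_cases hfe : f = e
    · have hge : g ≠ e := fun h => hne (hfe.trans h.symm)
      simp only [hfe, Function.update_self, Function.update_of_ne hge] at hc ⊢
      have := hfree x (hfe ▸ hx) g ((hK g hg).resolve_left hge) hge hc.symm y hy
      exact ⟨this.1, fun _ => this.2⟩
    · by_cases hge : g = e
      · simp only [Function.update_of_ne hfe] at hc ⊢
        simp only [hge, Function.update_self] at hc
        have := hfree y (hge ▸ hy) f ((hK f hf).resolve_left hfe) hfe hc x hx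
        exact ⟨this.1.symm, fun _ h => this.2 h.symm⟩
      · simp only [Function.update_of_ne hfe, Function.update_of_ne hge] at hc ⊢
        exact h1 f ((hK f hf).resolve_left hfe) g ((hK g hg).resolve_left hge) hne hc x hx y hy
  · intro f hf hc
    by_cases hfe : f = e
    · simp [hfe, hp] at hc
    · rw [Function.update_of_ne hfe] at hc
      exact h2 f ((hK f hf).resolve_left hfe) hc

/-- A partial coloring of `G - u`, where `u` has the two neighbors `a` and `b`, extends to `G`
as soon as two distinct nonzero colors are unused near the edges `ua` and `ub` respectively. -/
theorem PartialGood.exists_goodColoring {V : Type} {G : SimpleGraph V}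
    {c : Sym2 V → Fin 8} {u a b : V} (h : PartialGood G (G.deleteIncidenceSet u) c)
    (hab : a ≠ b) (hu : ∀ z, G.Adj u z ↔ z = a ∨ z = b)
    {p q : Fin 8} (hp : p ≠ 0) (hq : q ≠ 0) (hpq : p ≠ q)
    (hpa : ∀ z w, z = a ∨ z = b ∨ G.Adj a z → (G.deleteIncidenceSet u).Adj z w → c s(z, w) ≠ p)
    (hqb : ∀ z w, z = a ∨ z = b ∨ G.Adj b z → (G.deleteIncidenceSet u).Adj z w → c s(z, w) ≠ q) :
    ∃ c, GoodColoring G c := by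
  classical
  set H := G.deleteIncidenceSet u with hH
  have hHadj : ∀ {x y}, H.Adj x y ↔ G.Adj x y ∧ x ≠ u ∧ y ≠ u := G.deleteIncidenceSet_adj
  have free : ∀ v r, (∀ z w, z = a ∨ z = b ∨ G.Adj v z → H.Adj z w → c s(z, w) ≠ r) →
      (v = a ∨ v = b) →
      ∀ x ∈ s(u, v), ∀ f ∈ H.edgeSet, f ≠ s(u, v) → c f = r → ∀ y ∈ f, x ≠ y ∧ ¬G.Adj x y := by
    rintro v r hr hv x hx f hf - hc y ⟨w, rfl⟩
    have hyw := hHadj.1 hf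
    rw [Sym2.mem_iff] at hx
    rcases hx with rfl | rfl
    · exact ⟨hyw.2.1.symm, fun hxy => hr y w (by have := (hu y).1 hxy; tauto) hf hc⟩
    · refine ⟨?_, fun hxy => hr y w (Or.inr (Or.inr hxy)) hf hc⟩
      rintro rfl
      exact hr x w (by tauto) hf hc
  have hne : s(u, b) ≠ s(u, a) := by
    rw [Ne, Sym2.congr_right]
    exact hab.symm
  have hK : ∀ f, f ∈ (H ⊔ edge u a).edgeSet ↔ f ∈ H.edgeSet ∨ f = s(u, a) := by
    intro f
    have : u ≠ a := ((hu a).2 (Or.inl rfl)).ne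
    simp [edgeSet_sup, edgeSet_edge_of_ne this, or_comm]
  have h1 : PartialGood G (H ⊔ edge u a) (Function.update c s(u, a) p) :=
    h.update_extend (fun f hf => ((hK f).1 hf).symm) hp (free a p hpa (Or.inl rfl))
  refine ⟨_, (h1.update_extend (K := G) (e := s(u, b)) (p := q) ?_ hq ?_).goodColoring⟩
  · intro f hf
    rw [hK]
    by_cases huf : u ∈ f
    · obtain ⟨z, rfl⟩ := huf
      rcases (hu z).1 hf with rfl | rfl <;> simp
    · induction f with | _ x y
      simp only [Sym2.mem_iff, not_or] at huf
      exact Or.inr (Or.inl (hHadj.2 ⟨hf, Ne.symm huf.1, Ne.symm huf.2⟩))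
  · intro x hx f hf hfe hc
    rcases (hK f).1 hf with hf | rfl
    · refine free b q hqb (Or.inr rfl) x hx f hf hfe ?_
      rwa [Function.update_of_ne] at hc
      rintro rfl
      exact (hHadj.1 hf).2.1 rfl
    · simp [hpq] at hc

theorem exists_ne_notMem_or_nodup (l m : List (Fin 8)) (hl : l.length ≤ 7) (hm : m.length ≤ 7) :
    (∃ p q, p ∉ l ∧ q ∉ m ∧ p ≠ q) ∨
      (l.length = 7 ∧ l.Nodup) ∧ m.length = 7 ∧ m.Nodup := by
  have compl (k : List (Fin 8)) : (k.toFinsetᶜ).card + k.toFinset.card = 8 := by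
    rw [Finset.card_compl_add_card, Fintype.card_fin]
  have full (k : List (Fin 8)) (hk : k.length ≤ 7) (h : (k.toFinsetᶜ).card ≤ 1) :
      k.length = 7 ∧ k.Nodup := by
    have h1 := compl k
    have h2 := k.toFinset_card_le
    refine ⟨by omega, ?_⟩
    rw [← Multiset.coe_nodup, ← Multiset.toFinset_card_eq_card_iff_nodup]
    change k.toFinset.card = k.length
    omega
  have ne (k : List (Fin 8)) (hk : k.length ≤ 7) : (k.toFinsetᶜ).Nonempty := by
    have h1 := compl k
    have h2 := k.toFinset_card_le
    rw [← Finset.card_pos]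
    omega
  have two (k n : List (Fin 8)) (hn : n.length ≤ 7) (h : ¬ (k.toFinsetᶜ).card ≤ 1) :
      ∃ p q, p ∉ k ∧ q ∉ n ∧ p ≠ q := by
    obtain ⟨q, hq⟩ := ne n hn
    obtain ⟨p, hp, hpq⟩ := Finset.exists_mem_ne (not_le.1 h) q
    exact ⟨p, q, by simpa using hp, by simpa using hq, hpq⟩
  by_cases h1 : (l.toFinsetᶜ).card ≤ 1
  · by_cases h2 : (m.toFinsetᶜ).card ≤ 1
    · exact Or.inr ⟨full l hl h1, full m hm h2⟩
    · obtain ⟨p, q, hp, hq, hpq⟩ := two m l hl h2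
      exact Or.inl ⟨q, p, hq, hp, hpq.symm⟩
  · exact Or.inl (two l m hm h1)

theorem Subcubic.ncard_eq_three {V : Type} [Finite V] {G : SimpleGraph V} (hG : Subcubic G)
    {v x y z : V} (hx : G.Adj v x) (hy : G.Adj v y) (hz : G.Adj v z)
    (hxy : x ≠ y) (hxz : x ≠ z) (hyz : y ≠ z) : (G.neighborSet v).ncard = 3 := by
  refine le_antisymm (hG v) ?_
  rw [← Set.ncard_eq_three.2 ⟨x, y, z, hxy, hxz, hyz, rfl⟩]
  refine Set.ncard_le_ncard ?_ (Set.toFinite _)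
  rintro w (rfl | rfl | rfl) <;> assumption

theorem Subcubic.exists_third {V : Type} [Finite V] {G : SimpleGraph V} (hG : Subcubic G)
    {v x y : V} (hx : G.Adj v x) (hy : G.Adj v y) (hxy : x ≠ y) :
    ∃ z, G.Adj v z ∧ z ≠ x ∧ ∀ w, G.Adj v w → w = x ∨ w = y ∨ w = z := by
  by_cases h : ∃ z, G.Adj v z ∧ z ≠ x ∧ z ≠ y
  · obtain ⟨z, hz, hzx, hzy⟩ := h
    refine ⟨z, hz, hzx, fun w hw => ?_⟩
    by_contra! hne
    have hsub : ({w, x, y, z} : Set V) ⊆ G.neighborSet v := by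
      rintro t (rfl | rfl | rfl | rfl) <;> assumption
    have h4 := Set.ncard_le_ncard hsub (Set.toFinite _)
    rw [Set.ncard_insert_of_notMem (by simp [hne]) (Set.toFinite _),
      Set.ncard_eq_three.2 ⟨x, y, z, hxy, hzx.symm, hzy.symm, rfl⟩] at h4
    have := hG v
    omega
  · push Not at h
    refine ⟨y, hy, hxy.symm, fun w hw => ?_⟩
    by_cases hwx : w = x
    · exact Or.inl hwx
    · exact Or.inr (Or.inl (h w hw hwx))

theorem Subcubic.exists_two {V : Type} [Finite V] {G : SimpleGraph V} (hG : Subcubic G)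
    {v x : V} (hx : G.Adj v x) :
    ∃ y z, G.Adj v y ∧ G.Adj v z ∧ ∀ w, G.Adj v w → w = x ∨ w = y ∨ w = z := by
  by_cases h : ∃ y, G.Adj v y ∧ y ≠ x
  · obtain ⟨y, hy, hyx⟩ := h
    obtain ⟨z, hz, -, hw⟩ := hG.exists_third hx hy hyx.symm
    exact ⟨y, z, hy, hz, hw⟩
  · push Not at h
    exact ⟨x, x, hx, hx, fun w hw => Or.inl (h w hw)⟩

theorem SimpleGraph.Walk.IsCycle.exists_four_cycle {V : Type} {G : SimpleGraph V} {u : V}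
    {w : G.Walk u u} (hw : w.IsCycle) (hlen : w.length = 4) :
    ∃ a b d, G.Adj u a ∧ G.Adj a b ∧ G.Adj b d ∧ G.Adj d u ∧ u ≠ b ∧ a ≠ d := by
  match w, hw, hlen with
  | .cons (v := a) h1 (.cons (v := b) h2 (.cons (v := d) h3 (.cons h4 .nil))), hw, _ =>
    refine ⟨a, b, d, h1, h2, h3, h4, ?_, ?_⟩
    · have := hw.support_nodup
      simp at this
      grind
    · have := hw.support_nodup
      simp at this
      grind

/-- If `u` has degree 2 and lies on the 4-cycle `u a b d`, then a good coloring of `G - u` yields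
a good coloring of `G`. -/
theorem Subcubic.exists_goodColoring_of_four_cycle {V : Type} [Finite V] {G : SimpleGraph V}
    (hG : Subcubic G) {u a b d : V} (hau : G.Adj a u) (hab : G.Adj a b) (hdb : G.Adj d b)
    (hdu : G.Adj d u) (hub : u ≠ b) (had : a ≠ d) (hu : ∀ z, G.Adj u z ↔ z = a ∨ z = d)
    {c : Sym2 V → Fin 8} (hc : GoodColoring (G.deleteIncidenceSet u) c) :
    ∃ c, GoodColoring G c := by
  classical
  by_contra hno
  obtain ⟨a', haa', hau', Na⟩ := hG.exists_third hau hab hub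
  obtain ⟨d', hdd', hdu', Nd⟩ := hG.exists_third hdu hdb hub
  obtain ⟨b', hbb', -, Nb⟩ := hG.exists_third hab.symm hdb.symm had
  obtain ⟨x, y, hx, hy, Na'⟩ := hG.exists_two haa'.symm
  obtain ⟨z, w, hz, hw, Nd'⟩ := hG.exists_two hdd'.symm
  set H := G.deleteIncidenceSet u with hH
  have hHadj : ∀ {x y}, H.Adj x y ↔ G.Adj x y ∧ x ≠ u ∧ y ≠ u := G.deleteIncidenceSet_adj
  have key : ∀ c, PartialGood G H c → ∀ l m : List (Fin 8), l.length ≤ 7 → m.length ≤ 7 →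
      (∀ r ∈ [0, c s(a, b), c s(d, b), c s(a, a'), c s(d, d'), c s(b, b')], r ∈ l ∧ r ∈ m) →
      c s(a', x) ∈ l → c s(a', y) ∈ l → c s(d', z) ∈ m → c s(d', w) ∈ m →
      (l.length = 7 ∧ l.Nodup) ∧ m.length = 7 ∧ m.Nodup := by
    intro c hc l m hl hm hr hxl hyl hzm hwm
    refine (exists_ne_notMem_or_nodup l m hl hm).resolve_left ?_
    rintro ⟨p, q, hp, hq, hpq⟩
    simp only [List.mem_cons, List.not_mem_nil, or_false, forall_eq_or_imp, forall_eq] at hr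
    refine hno (hc.exists_goodColoring had hu (p := p) (q := q) ?_ ?_ hpq ?_ ?_)
    · rintro rfl; exact hp hr.1.1
    · rintro rfl; exact hq hr.1.2
    · have := fun t => Sym2.eq_swap (a := b) (b := t)
      have := fun t => Sym2.eq_swap (a := a') (b := t)
      rintro s t hs hst rfl
      rw [hHadj] at hst
      have := Na s
      have := Na t
      have := Nd t
      have := Nb t
      have := Na' t
      grind
    · have := fun t => Sym2.eq_swap (a := b) (b := t)
      have := fun t => Sym2.eq_swap (a := d') (b := t)
      rintro s t hs hst rfl
      rw [hHadj] at hst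
      have := Nd s
      have := Na t
      have := Nd t
      have := Nb t
      have := Nd' t
      grind
  have nz : ∀ v v', (∀ t, G.Adj v t → t = u ∨ t = b ∨ t = v') → ∀ t, H.Adj v t →
      c s(v, t) ≠ 0 := by
    intro v v' hv t ht h0
    have h3 := (hc.2 v t ht h0).1
    have hsub : H.neighborSet v ⊆ {b, v'} := by
      intro r hr
      rw [mem_neighborSet, hHadj] at hr
      have := hv r hr.1
      simp only [Set.mem_insert_iff, Set.mem_singleton_iff]
      tauto
    have := Set.ncard_le_ncard hsub (Set.toFinite _)
    have := Set.ncard_insert_le b {v'}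
    have := Set.ncard_singleton v'
    omega
  have hα := nz a a' Na b (hHadj.2 ⟨hab, hau.ne, hub.symm⟩)
  have hγ := nz a a' Na a' (hHadj.2 ⟨haa', hau.ne, hau'⟩)
  have hβ := nz d d' Nd b (hHadj.2 ⟨hdb, hdu.ne, hub.symm⟩)
  have hδ := nz d d' Nd d' (hHadj.2 ⟨hdd', hdu.ne, hdu'⟩)
  have hc := hc.partialGood_deleteIncidenceSet hG
  have upd_mem : ∀ (c : Sym2 V → Fin 8) e f (l : List (Fin 8)), 0 ∈ l → c f ∈ l →
      Function.update c e 0 f ∈ l := by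
    intro c e f l h0 hf
    by_cases h : f = e
    · simpa [h] using h0
    · rwa [Function.update_of_ne h]
  have upd : ∀ (c : Sym2 V → Fin 8) e f, Function.update c e 0 f = 0 ∨
      Function.update c e 0 f = c f := by
    intro c e f
    by_cases h : f = e
    · simp [h]
    · exact Or.inr (Function.update_of_ne h _ _)
  have deg_a' : c s(a, a') ≠ c s(a', x) → c s(a, a') ≠ c s(a', y) → c s(a', x) ≠ c s(a', y) →
      (G.neighborSet a').ncard = 3 := by
    intro h1 h2 h3
    refine hG.ncard_eq_three haa'.symm hx hy ?_ ?_ ?_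
    · rintro rfl; exact h1 (congrArg c Sym2.eq_swap)
    · rintro rfl; exact h2 (congrArg c Sym2.eq_swap)
    · rintro rfl; exact h3 rfl
  by_cases hε : c s(b, b') = 0 ∨ c s(b, b') = c s(a, b) ∨ c s(b, b') = c s(d, b)
  · have h1 := key c hc
      [0, c s(a, b), c s(d, b), c s(a, a'), c s(d, d'), c s(a', x), c s(a', y)]
      [0, c s(a, b), c s(d, b), c s(a, a'), c s(d, d'), c s(d', z), c s(d', w)]
      (by simp) (by simp) (by simp; tauto) (by simp) (by simp) (by simp) (by simp)
    replace h1 := h1.1.2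
    simp only [List.nodup_cons, List.mem_cons, List.not_mem_nil, or_false, not_or] at h1
    obtain ⟨⟨-, -, -, -, hx0, hy0⟩, ⟨-, hαγ, -⟩, -, ⟨-, hγx, hγy⟩, -, hxy, -⟩ := h1
    have hba' : b ≠ a' := by rintro rfl; exact hαγ rfl
    have hc1 := hc.update_zero (a := a) (b := a')
      (hG.ncard_eq_three hau hab haa' hub hau'.symm hba')
      (deg_a' hγx hγy hxy) ?_ ?_
    · have h2 := key _ hc1
        [0, c s(a, b), c s(d, b), c s(d, d'), c s(a', x), c s(a', y)]
        [0, c s(a, b), c s(d, b), c s(d, d'), Function.update c s(a, a') 0 s(d', z),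
          Function.update c s(a, a') 0 s(d', w)]
        (by simp) (by simp) ?_ ?_ ?_ (by simp) (by simp)
      · simp at h2
      · rw [List.forall_mem_cons, List.forall_mem_cons, List.forall_mem_cons,
          List.forall_mem_cons, List.forall_mem_cons, List.forall_mem_singleton]
        have hε' : ∀ l : List (Fin 8), 0 ∈ l → c s(a, b) ∈ l → c s(d, b) ∈ l →
            c s(b, b') ∈ l := by
          intro l h0 h1 h2
          rcases hε with h | h | h <;> rwa [h]
        refine ⟨by simp, ⟨?_, ?_⟩, ⟨?_, ?_⟩, by simp, ⟨?_, ?_⟩, ?_, ?_⟩ <;>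
          refine upd_mem _ _ _ _ (by simp) ?_
        iterate 6 simp
        all_goals exact hε' _ (by simp) (by simp) (by simp)
      · exact upd_mem _ _ _ _ (by simp) (by simp)
      · exact upd_mem _ _ _ _ (by simp) (by simp)
    · intro t ht hta
      exact nz a a' Na t ht
    · intro t ht hta
      rcases Na' t (hHadj.1 ht).1 with rfl | rfl | rfl
      · exact absurd rfl hta
      · exact Ne.symm hx0
      · exact Ne.symm hy0
  push Not at hε
  have hba : c s(b, a) = c s(a, b) := congrArg c Sym2.eq_swap
  have hbd : c s(b, d) = c s(d, b) := congrArg c Sym2.eq_swap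
  have hab' : a ≠ b' := by rintro rfl; exact hε.2.1 hba
  have hdb' : d ≠ b' := by rintro rfl; exact hε.2.2 hbd
  have nzb : ∀ t, H.Adj b t → c s(b, t) ≠ 0 := by
    intro t ht
    rcases Nb t (hHadj.1 ht).1 with rfl | rfl | rfl
    · rwa [hba]
    · rwa [hbd]
    · exact hε.1
  have deg_b := hG.ncard_eq_three hab.symm hdb.symm hbb' had hab' hdb'
  have hba' : b ≠ a' := by
    rintro rfl
    have h1 := key c hc
      [0, c s(a, b), c s(d, b), c s(d, d'), c s(b, b')]
      [0, c s(a, b), c s(d, b), c s(d, d'), c s(b, b'), c s(d', z), c s(d', w)]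
      (by simp) (by simp) (by simp) ?_ ?_ (by simp) (by simp)
    · simp at h1
    · rcases Nb x hx with rfl | rfl | rfl <;> simp [hba, hbd]
    · rcases Nb y hy with rfl | rfl | rfl <;> simp [hba, hbd]
  have hbd' : b ≠ d' := by
    rintro rfl
    have h1 := key c hc
      [0, c s(a, b), c s(d, b), c s(a, a'), c s(b, b'), c s(a', x), c s(a', y)]
      [0, c s(a, b), c s(d, b), c s(a, a'), c s(b, b')]
      (by simp) (by simp) (by simp) (by simp) (by simp) ?_ ?_
    · simp at h1
    · rcases Nb z hz with rfl | rfl | rfl <;> simp [hba, hbd]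
    · rcases Nb w hw with rfl | rfl | rfl <;> simp [hba, hbd]
  have deg_a := hG.ncard_eq_three hau hab haa' hub hau'.symm hba'
  have deg_d := hG.ncard_eq_three hdu hdb hdd' hub hdu'.symm hbd'
  have hc1 := hc.update_zero deg_a deg_b (fun t ht _ => nz a a' Na t ht) (fun t ht _ => nzb t ht)
  have hc2 := hc.update_zero deg_d deg_b (fun t ht _ => nz d d' Nd t ht) (fun t ht _ => nzb t ht)
  have h1 : [0, c s(d, b), c s(a, a'), c s(d, d'), c s(b, b'), c s(a', x), c s(a', y)].Nodup := by
    have h1 := key _ hc1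
      [0, c s(d, b), c s(a, a'), c s(d, d'), c s(b, b'),
        Function.update c s(a, b) 0 s(a', x), Function.update c s(a, b) 0 s(a', y)]
      [0, c s(d, b), c s(a, a'), c s(d, d'), c s(b, b'),
        Function.update c s(a, b) 0 s(d', z), Function.update c s(a, b) 0 s(d', w)]
      (by simp) (by simp) ?_ (by simp) (by simp) (by simp) (by simp)
    · replace h1 := h1.1.2
      have hx1 := upd c s(a, b) s(a', x)
      have hy1 := upd c s(a, b) s(a', y)
      rcases hx1 with hx1 | hx1
      · simp [hx1] at h1
      rcases hy1 with hy1 | hy1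
      · simp [hy1] at h1
      rwa [hx1, hy1] at h1
    · rw [List.forall_mem_cons, List.forall_mem_cons, List.forall_mem_cons,
        List.forall_mem_cons, List.forall_mem_cons, List.forall_mem_singleton]
      refine ⟨by simp, by simp, ⟨?_, ?_⟩, ⟨?_, ?_⟩, ⟨?_, ?_⟩, ?_, ?_⟩ <;>
        exact upd_mem _ _ _ _ (by simp) (by simp)
  simp only [List.nodup_cons, List.mem_cons, List.not_mem_nil, or_false, not_or] at h1
  obtain ⟨⟨-, -, -, -, hx0, hy0⟩, ⟨-, -, -, hβx, hβy⟩, ⟨-, -, hγx, hγy⟩, -, -, hxy, -⟩ := h1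
  have off : ∀ {e : Sym2 V}, c e ≠ 0 → c e ≠ c s(d, b) →
      Function.update c s(d, b) 0 e ≠ 0 := by
    intro e he hne
    rwa [Function.update_of_ne]
    rintro rfl
    exact hne rfl
  have hc3 := hc2.update_zero (a := a) (b := a') deg_a
    (deg_a' hγx hγy hxy) ?_ ?_
  · have h2 := key _ hc3
      [0, c s(a, b), c s(d, d'), c s(b, b'), c s(a', x), c s(a', y)]
      [0, c s(a, b), c s(d, d'), c s(b, b'),
        Function.update (Function.update c s(d, b) 0) s(a, a') 0 s(d', z),
        Function.update (Function.update c s(d, b) 0) s(a, a') 0 s(d', w)]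
      (by simp) (by simp) ?_ ?_ ?_ (by simp) (by simp)
    · simp at h2
    · rw [List.forall_mem_cons, List.forall_mem_cons, List.forall_mem_cons,
        List.forall_mem_cons, List.forall_mem_cons, List.forall_mem_singleton]
      refine ⟨by simp, ⟨?_, ?_⟩, ⟨?_, ?_⟩, by simp, ⟨?_, ?_⟩, ?_, ?_⟩ <;>
        refine upd_mem _ _ _ _ (by simp) ?_
      iterate 2 exact upd_mem _ _ _ _ (by simp) (by simp)
      iterate 2 simp
      iterate 4 exact upd_mem _ _ _ _ (by simp) (by simp)
    · exact upd_mem _ _ _ _ (by simp) (upd_mem _ _ _ _ (by simp) (by simp))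
    · exact upd_mem _ _ _ _ (by simp) (upd_mem _ _ _ _ (by simp) (by simp))
  · intro t ht hta
    rw [Function.update_of_ne]
    · exact nz a a' Na t ht
    · intro h
      have : a ∈ s(d, b) := h ▸ Sym2.mem_mk_left a t
      rw [Sym2.mem_iff] at this
      exact this.elim had hab.ne
  · intro t ht hta
    rcases Na' t (hHadj.1 ht).1 with rfl | rfl | rfl
    · exact absurd rfl hta
    · exact off (Ne.symm hx0) (Ne.symm hβx)
    · exact off (Ne.symm hy0) (Ne.symm hβy)

/-- In a minimal counterexample, no cycle of length 4 contains a vertex of degree 2. -/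
theorem minCounter_no_deg2_on_C4 {V : Type} [Finite V] (G : SimpleGraph V)
    (hG : MinCounter V G) :
    ∀ (v : V) (w : G.Walk v v), w.IsCycle → w.length = 4 →
      ∀ u ∈ w.support, (G.neighborSet u).ncard ≠ 2 := by
  classical
  intro v w hw hlen u hu h2
  obtain ⟨a, b, d, h1, h3, h4, h5, hub, had⟩ :=
    (hw.rotate hu).exists_four_cycle (by rw [Walk.length_rotate, hlen])
  obtain ⟨hsub, hno, hmin⟩ := hG
  have hN : ({a, d} : Set V) = G.neighborSet u := by
    refine Set.eq_of_subset_of_ncard_le ?_ ?_ (Set.toFinite _)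
    · rintro t (rfl | rfl)
      exacts [h1, h5.symm]
    · rw [h2, Set.ncard_pair had]
  have hle := G.deleteIncidenceSet_le u
  obtain ⟨c, hc⟩ := hmin V (G.deleteIncidenceSet u)
    (fun t => (Set.ncard_le_ncard (fun z hz => hle hz) (Set.toFinite _)).trans (hsub t)) (by
      refine Nat.add_lt_add_left (Set.ncard_lt_ncard ⟨edgeSet_mono hle, fun h => ?_⟩
        (Set.toFinite _)) _
      have : (G.deleteIncidenceSet u).Adj u a := h ((mem_edgeSet G).2 h1)
      exact (G.deleteIncidenceSet_adj.1 this).2.1 rfl)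
  exact hno (hsub.exists_goodColoring_of_four_cycle h1.symm h3 h4.symm h5 hub had
    (fun z => by rw [← mem_neighborSet, ← hN]; rfl) hc)
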